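/- For every positive integer r there exists an integer N(r) with the following property: whenever n ≥ N(r) and C ⊆ (ZMod 4)^n is a Z4-linear code whose set of Lee weights of nonzero codewords is exactly {w1, w2, w3} with w1 < w2 < w3, such that every nonzero vector of C⊥ has Lee weight at least 3, w1 + w2 + w3 = 3n, and w2 = n, then 2^r divides n and 2^(r−1) divides each of w1, w2 and w3. -/

import Mathlib

/-- The Lee (= homogeneous) weight on `ZMod 4`: wt 0 = 0, wt 1 = wt 3 = 1, wt 2 = 2. -/
def leeWt (x : ZMod 4) : ℕ := if x = 0 then 0 else if x = 2 then 2 else 1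

/-- The Lee weight of a vector, extended coordinatewise. -/
def leeWtVec {n : ℕ} (v : Fin n → ZMod 4) : ℕ := ∑ i, leeWt (v i)

/-- The dual code of a linear code `C` over a commutative ring, with respect to the
standard inner product. -/
def dualCode {R : Type*} [CommRing R] {n : ℕ} (C : Submodule R (Fin n → R)) :
    Submodule R (Fin n → R) where
  carrier := {x | ∀ c ∈ C, ∑ i, x i * c i = 0}
  add_mem' := by
    intro a b ha hb c hc
    simp only [Set.mem_setOf_eq] at *
    simp [Pi.add_apply, add_mul, Finset.sum_add_distrib, ha c hc, hb c hc]
  zero_mem' := by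
    intro c hc
    simp
  smul_mem' := by
    intro r a ha c hc
    simp only [Set.mem_setOf_eq] at *
    simp [Pi.smul_apply, smul_eq_mul, mul_assoc, ← Finset.mul_sum, ha c hc]

/-- The real part `1 - leeWt x` of the standard additive character of `ZMod 4`. -/
def leeChar (x : ZMod 4) : ℤ := 1 - leeWt x

lemma two_mul_leeChar_mul (x y : ZMod 4) :
    2 * (leeChar x * leeChar y) = leeChar (x + y) + leeChar (x - y) := by
  revert x y; unfold leeChar leeWt; decide

lemma leeChar_zero : leeChar 0 = 1 := by decide

lemma leeChar_ne_one {x : ZMod 4} (hx : x ≠ 0) : leeChar x ≠ 1 := by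
  revert x; unfold leeChar leeWt; decide

lemma sum_leeChar {n : ℕ} (v : Fin n → ZMod 4) :
    ∑ i, leeChar (v i) = n - leeWtVec v := by
  simp [leeChar, leeWtVec]

lemma leeWtVec_pos {n : ℕ} {v : Fin n → ZMod 4} (hv : v ≠ 0) : 0 < leeWtVec v := by
  obtain ⟨i, hi⟩ := Function.ne_iff.mp hv
  refine Finset.sum_pos' (fun _ _ => Nat.zero_le _) ⟨i, Finset.mem_univ i, ?_⟩
  rw [Pi.zero_apply] at hi
  generalize v i = x at hi
  revert x; unfold leeWt; decide

lemma leeWtVec_add_le {n : ℕ} (v w : Fin n → ZMod 4) :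
    leeWtVec (v + w) ≤ leeWtVec v + leeWtVec w := by
  have h : ∀ x y : ZMod 4, leeWt (x + y) ≤ leeWt x + leeWt y := by unfold leeWt; decide
  rw [leeWtVec, leeWtVec, leeWtVec, ← Finset.sum_add_distrib]
  exact Finset.sum_le_sum fun i _ => h _ _

lemma leeWtVec_single {n : ℕ} (i : Fin n) (a : ZMod 4) :
    leeWtVec (Pi.single i a) = leeWt a := by
  rw [leeWtVec, Finset.sum_eq_single i]
  · simp
  · intro j _ hj
    simp [hj, leeWt]
  · simp

/-- A character of a finite group that is not trivial sums to zero. -/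
lemma sum_leeChar_eq_zero {M : Type*} [AddCommGroup M] [Fintype M] (φ : M →+ ZMod 4)
    {a : M} (ha : φ a ≠ 0) : ∑ c, leeChar (φ c) = 0 := by
  have h₁ : ∑ c, leeChar (φ (c + a)) = ∑ c, leeChar (φ c) :=
    Equiv.sum_comp (Equiv.addRight a) fun c => leeChar (φ c)
  have h₂ : ∑ c, leeChar (φ (c - a)) = ∑ c, leeChar (φ c) :=
    Equiv.sum_comp (Equiv.subRight a) fun c => leeChar (φ c)
  have h : 2 * ((∑ c, leeChar (φ c)) * leeChar (φ a)) =
      ∑ c, leeChar (φ (c + a)) + ∑ c, leeChar (φ (c - a)) := by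
    simp only [Finset.sum_mul, Finset.mul_sum, two_mul_leeChar_mul, map_add, map_sub,
      Finset.sum_add_distrib]
  rw [h₁, h₂] at h
  by_contra h0
  exact leeChar_ne_one ha (mul_left_cancel₀ h0 (by linarith))

lemma card_dvd_sum_leeChar {M : Type*} [AddCommGroup M] [Fintype M] (φ : M →+ ZMod 4) :
    (Fintype.card M : ℤ) ∣ ∑ c, leeChar (φ c) := by
  by_cases h : ∃ a, φ a ≠ 0
  · obtain ⟨a, ha⟩ := h
    simp [sum_leeChar_eq_zero φ ha]
  · push Not at h
    simp [h, leeChar_zero]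

/-- The inner product with `d` as an additive functional on a code. -/
def codeFunctional {n : ℕ} (C : Submodule (ZMod 4) (Fin n → ZMod 4)) (d : Fin n → ZMod 4) :
    C →+ ZMod 4 where
  toFun c := d ⬝ᵥ c
  map_zero' := by simp
  map_add' := by simp

/-- The deviation `n - wt c` of the Lee weight from the length. -/
def leeDev {n : ℕ} (c : Fin n → ZMod 4) : ℤ := ∑ i, leeChar (c i)

lemma leeDev_zero {n : ℕ} : leeDev (0 : Fin n → ZMod 4) = n := by
  simp [leeDev, leeChar_zero]

lemma sum_leeChar_dotProduct {n : ℕ} (C : Submodule (ZMod 4) (Fin n → ZMod 4)) [Fintype C]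
    (hC : ∀ d ∈ dualCode C, d ≠ 0 → 3 ≤ leeWtVec d) {d : Fin n → ZMod 4} (hd : d ≠ 0)
    (hw : leeWtVec d ≤ 2) : ∑ c : C, leeChar (d ⬝ᵥ (c : Fin n → ZMod 4)) = 0 := by
  have h : d ∉ dualCode C := fun h => absurd (hC d h hd) (by omega)
  obtain ⟨c, hc, hc0⟩ : ∃ c ∈ C, d ⬝ᵥ c ≠ 0 := by
    by_contra! h'
    exact h h'
  exact sum_leeChar_eq_zero (codeFunctional C d) (a := ⟨c, hc⟩) hc0

lemma sum_leeDev {n : ℕ} (C : Submodule (ZMod 4) (Fin n → ZMod 4)) [Fintype C]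
    (hC : ∀ d ∈ dualCode C, d ≠ 0 → 3 ≤ leeWtVec d) :
    ∑ c : C, leeDev (c : Fin n → ZMod 4) = 0 := by
  unfold leeDev
  rw [Finset.sum_comm]
  refine Finset.sum_eq_zero fun i _ => ?_
  simpa using sum_leeChar_dotProduct C hC (d := Pi.single i 1)
    (by rw [ne_eq, Pi.single_eq_zero_iff]; decide) (by rw [leeWtVec_single]; decide)

lemma two_mul_sum_leeDev_sq {n : ℕ} (C : Submodule (ZMod 4) (Fin n → ZMod 4)) [Fintype C]
    (hC : ∀ d ∈ dualCode C, d ≠ 0 → 3 ≤ leeWtVec d) :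
    2 * ∑ c : C, leeDev (c : Fin n → ZMod 4) ^ 2 = n * Fintype.card C := by
  have h₁ : 2 * ∑ c : C, leeDev (c : Fin n → ZMod 4) ^ 2 =
      ∑ i, ∑ j, ∑ c : C, (leeChar ((c : Fin n → ZMod 4) i + (c : Fin n → ZMod 4) j) +
        leeChar ((c : Fin n → ZMod 4) i - (c : Fin n → ZMod 4) j)) := by
    simp only [leeDev, sq, Finset.sum_mul_sum]
    simp only [Finset.mul_sum, two_mul_leeChar_mul]
    rw [Finset.sum_comm]
    exact Finset.sum_congr rfl fun i _ => Finset.sum_comm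
  have h₂ : ∀ i j : Fin n,
      ∑ c : C, (leeChar ((c : Fin n → ZMod 4) i + (c : Fin n → ZMod 4) j) +
        leeChar ((c : Fin n → ZMod 4) i - (c : Fin n → ZMod 4) j)) =
      if i = j then (Fintype.card C : ℤ) else 0 := by
    intro i j
    rw [Finset.sum_add_distrib]
    split_ifs with hij
    · subst hij
      have h := sum_leeChar_dotProduct C hC (d := Pi.single i 2)
        (by simp only [ne_eq, Pi.single_eq_zero_iff]; decide)
        (by rw [leeWtVec_single]; decide)
      simp only [single_dotProduct, two_mul] at h
      simp [h, leeChar_zero]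
    · have hne : ∀ a : ZMod 4, (Pi.single i 1 + Pi.single j a : Fin n → ZMod 4) ≠ 0 := by
        intro a h
        have h' := congrFun h i
        simp only [Pi.add_apply, Pi.single_eq_same, Pi.single_eq_of_ne hij, add_zero,
          Pi.zero_apply] at h'
        exact absurd h' (by decide)
      have hw : ∀ a : ZMod 4, leeWt a ≤ 1 →
          leeWtVec (Pi.single i 1 + Pi.single j a : Fin n → ZMod 4) ≤ 2 := by
        intro a ha
        refine (leeWtVec_add_le _ _).trans ?_
        rw [leeWtVec_single, leeWtVec_single]
        exact Nat.add_le_add (by decide) ha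
      have hp := sum_leeChar_dotProduct C hC (hne 1) (hw 1 (by decide))
      have hm := sum_leeChar_dotProduct C hC (hne (-1)) (hw (-1) (by decide))
      simp only [add_dotProduct, single_dotProduct, one_mul, neg_mul, ← sub_eq_add_neg] at hp hm
      rw [hp, hm, add_zero]
  rw [h₁]
  simp [h₂]

lemma card_dvd_four_mul_sum_leeDev_cube {n : ℕ} (C : Submodule (ZMod 4) (Fin n → ZMod 4))
    [Fintype C] :
    (Fintype.card C : ℤ) ∣ 4 * ∑ c : C, leeDev (c : Fin n → ZMod 4) ^ 3 := by
  have h₀ : ∀ x y z : ZMod 4, 4 * (leeChar x * leeChar y * leeChar z) =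
      leeChar (x + y + z) + leeChar (x + y - z) + leeChar (x - y + z) + leeChar (x - y - z) := by
    unfold leeChar leeWt; decide
  have h₁ : 4 * ∑ c : C, leeDev (c : Fin n → ZMod 4) ^ 3 = ∑ i, ∑ k, ∑ j, ∑ c : C,
      4 * (leeChar ((c : Fin n → ZMod 4) i) * leeChar ((c : Fin n → ZMod 4) j) *
        leeChar ((c : Fin n → ZMod 4) k)) := by
    simp only [leeDev, pow_three', Finset.sum_mul_sum]
    simp only [Finset.sum_mul]
    simp only [Finset.mul_sum]
    rw [Finset.sum_comm]
    refine Finset.sum_congr rfl fun i _ => ?_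
    rw [Finset.sum_comm]
    exact Finset.sum_congr rfl fun k _ => Finset.sum_comm
  rw [h₁]
  refine Finset.dvd_sum fun i _ => Finset.dvd_sum fun k _ => Finset.dvd_sum fun j _ => ?_
  simp only [h₀, Finset.sum_add_distrib]
  have h : ∀ a b : ZMod 4, (Fintype.card C : ℤ) ∣ ∑ c : C, leeChar
      ((c : Fin n → ZMod 4) i + a * (c : Fin n → ZMod 4) j + b * (c : Fin n → ZMod 4) k) := by
    intro a b
    have h := card_dvd_sum_leeChar
      (codeFunctional C (Pi.single i 1 + Pi.single j a + Pi.single k b))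
    simpa only [codeFunctional, AddMonoidHom.coe_mk, ZeroHom.coe_mk, add_dotProduct,
      single_dotProduct, one_mul] using h
  have hpp := h 1 1
  have hpm := h 1 (-1)
  have hmp := h (-1) 1
  have hmm := h (-1) (-1)
  simp only [one_mul, neg_mul, ← sub_eq_add_neg] at hpp hpm hmp hmm
  exact dvd_add (dvd_add (dvd_add hpp hpm) hmp) hmm

lemma exists_card_eq_two_pow {n : ℕ} (C : Submodule (ZMod 4) (Fin n → ZMod 4)) [Fintype C] :
    ∃ m, Fintype.card C = 2 ^ m := by
  have h := AddSubgroup.card_addSubgroup_dvd_card C.toAddSubgroup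
  have h' : Nat.card C ∣ 2 ^ (2 * n) := by
    rw [pow_mul]
    simpa [Nat.card_eq_fintype_card, ZMod.card] using h
  obtain ⟨m, -, hm⟩ := (Nat.dvd_prime_pow Nat.prime_two).1 h'
  exact ⟨m, by rw [← Nat.card_eq_fintype_card, hm]⟩

/-- A power of two dividing a product of three consecutive positive integers is at most twice
the largest factor. -/
lemma two_pow_le_of_dvd_consecutive {k u : ℕ} (hu : 1 ≤ u) (h : 2 ^ k ∣ u * (u + 1) * (u + 2)) :
    2 ^ k ≤ 2 * (u + 2) := by
  have cop : ∀ a : ℕ, Odd a → Nat.Coprime (2 ^ k) a := fun a ha =>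
    Nat.Coprime.pow_left k ha.coprime_two_left
  rcases Nat.even_or_odd u with hu2 | hu2
  · obtain ⟨v, rfl⟩ := hu2
    have h' : 2 ^ k ∣ 4 * v * (v + 1) := by
      have e : (v + v) * (v + v + 1) * (v + v + 2) = (4 * v * (v + 1)) * (v + v + 1) := by ring
      rw [e] at h
      exact (cop (v + v + 1) ⟨v, by ring⟩).dvd_of_dvd_mul_right h
    rcases Nat.even_or_odd v with hv | hv
    · have := Nat.le_of_dvd (by omega)
        ((cop (v + 1) hv.add_one).dvd_of_dvd_mul_right h')
      omega
    · have e : 4 * v * (v + 1) = (4 * (v + 1)) * v := by ring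
      rw [e] at h'
      have := Nat.le_of_dvd (by omega) ((cop v hv).dvd_of_dvd_mul_right h')
      omega
  · have h' := (cop (u + 2) (hu2.add_even even_two)).dvd_of_dvd_mul_right h
    have := Nat.le_of_dvd (by omega) ((cop u hu2).dvd_of_dvd_mul_left h')
    omega

/-- The cofactor of `t` in a multiple of `2 ^ m` is divisible by `2 ^ m` up to a factor bounded
in terms of the power of two dividing `t`. -/
lemma two_pow_dvd_of_dvd_cube_mul {r m t X : ℕ} (ht : t ≠ 0) (hr : ¬ 2 ^ r ∣ t)
    (h : 2 ^ m ∣ 4 * t ^ 3 * X) : 2 ^ (m - (3 * r + 2)) ∣ X := by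
  obtain ⟨a, b, hb, rfl⟩ := Nat.exists_eq_two_pow_mul_odd ht
  have har : a < r := by
    by_contra! har
    exact hr (Dvd.dvd.mul_right (pow_dvd_pow 2 har) b)
  have e : 4 * (2 ^ a * b) ^ 3 * X = 2 ^ (3 * a + 2) * X * b ^ 3 := by ring
  rw [e] at h
  have h' := (Nat.Coprime.pow m 3 hb.coprime_two_left).dvd_of_dvd_mul_right h
  by_cases hm : m ≤ 3 * a + 2
  · rw [Nat.sub_eq_zero_of_le (by omega)]
    simp
  · have e2 : m = (3 * a + 2) + (m - (3 * a + 2)) := by omega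
    rw [e2, pow_add] at h'
    exact (pow_dvd_pow 2 (by omega)).trans (Nat.dvd_of_mul_dvd_mul_left (by positivity) h')

/-- The arithmetic constraints satisfied by the size `2 ^ m`, the length `t * s` and the weight
gap `t` bound the size, unless `t` is highly divisible by two. -/
lemma two_pow_le_of_not_dvd {r m t s : ℕ} (ht : 1 ≤ t) (hs : 2 ≤ s) (hr : ¬ 2 ^ r ∣ t)
    (hdvd : (2 : ℤ) ^ m ∣ 4 * ((t * s) ^ 3 - t ^ 2 * (t * s)))
    (hlow : 2 * (t * s : ℤ) + 2 * t < 2 ^ m)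
    (hup : (s : ℤ) * (2 ^ m - 2 * (t * s)) ≤ 2 * t * (2 ^ m - 1)) :
    2 ^ m ≤ (2 ^ (3 * r + 4)) ^ 6 := by
  have hX : 2 ^ m ∣ 4 * t ^ 3 * ((s - 1) * (s - 1 + 1) * (s - 1 + 2)) := by
    obtain ⟨u, rfl⟩ : ∃ u, s = u + 1 := ⟨s - 1, by omega⟩
    rw [← Int.natCast_dvd_natCast]
    simp only [Nat.add_sub_cancel]
    push_cast at hdvd ⊢
    convert hdvd using 1
    ring
  have hle := two_pow_le_of_dvd_consecutive (by omega)
    (two_pow_dvd_of_dvd_cube_mul (by omega) hr hX)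
  have hM : 2 ^ m ≤ 2 ^ (3 * r + 4) * s := calc
    2 ^ m ≤ 2 ^ ((3 * r + 2) + (m - (3 * r + 2))) := Nat.pow_le_pow_right (by norm_num) (by omega)
    _ = 2 ^ (3 * r + 2) * 2 ^ (m - (3 * r + 2)) := pow_add _ _ _
    _ ≤ 2 ^ (3 * r + 2) * (4 * s) := Nat.mul_le_mul_left _ (by omega)
    _ = 2 ^ (3 * r + 4) * s := by ring
  zify at hM ht hs ⊢
  generalize (2 : ℤ) ^ m = M at *
  generalize (2 : ℤ) ^ (3 * r + 4) = L at *
  generalize (s : ℤ) = s at *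
  generalize (t : ℤ) = t at *
  have htL : 2 * t ≤ L := le_of_mul_le_mul_right (by linarith : 2 * t * s ≤ L * s) (by linarith)
  have hDL : M - 2 * (t * s) ≤ L ^ 2 := by
    have h1 : s * (M - 2 * (t * s)) ≤ s * (2 * t * L) := by nlinarith
    have h2 := le_of_mul_le_mul_left h1 (by linarith)
    nlinarith
  set D := M - 2 * (t * s) with hD
  have hDt : 2 * t < D := by linarith
  have hMD : M ∣ D * (D ^ 2 - 4 * t ^ 2) := by
    have e : D * (D ^ 2 - 4 * t ^ 2) =
        M * (M ^ 2 - 3 * M * (2 * (t * s)) + 3 * (2 * (t * s)) ^ 2 - 4 * t ^ 2)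
        - 2 * (4 * ((t * s) ^ 3 - t ^ 2 * (t * s))) := by rw [hD]; ring
    rw [e]
    exact dvd_sub (dvd_mul_right _ _) (hdvd.mul_left 2)
  have hpos : 0 < D * (D ^ 2 - 4 * t ^ 2) := mul_pos (by linarith) (by nlinarith)
  calc M ≤ D * (D ^ 2 - 4 * t ^ 2) := Int.le_of_dvd hpos hMD
    _ ≤ D ^ 3 := by nlinarith [mul_nonneg (by linarith : (0 : ℤ) ≤ D) (sq_nonneg t)]
    _ ≤ (L ^ 2) ^ 3 := pow_le_pow_left₀ (by linarith) hDL 3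
    _ = L ^ 6 := by ring

/-- For `n` beyond a bound, the weight gap of a projective three-weight code with weights
`n - t`, `n`, `n + t` is divisible by `2 ^ r`. -/
lemma two_pow_dvd_and_dvd_of_three_weights {n t r : ℕ}
    (C : Submodule (ZMod 4) (Fin n → ZMod 4))
    (hC : ∀ d ∈ dualCode C, d ≠ 0 → 3 ≤ leeWtVec d) (ht : 0 < t) (htn : t < n)
    (hwt : ∀ c ∈ C, c ≠ 0 → leeDev c = t ∨ leeDev c = 0 ∨ leeDev c = -t)
    (hex : ∃ c ∈ C, c ≠ 0 ∧ leeDev c = t) (hn : (2 ^ (3 * r + 4)) ^ 6 ≤ n) :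
    2 ^ r ∣ t ∧ t ∣ n := by
  classical
  have : Fintype C := Fintype.ofFinite C
  obtain ⟨m, hm⟩ := exists_card_eq_two_pow C
  have hsplit : ∀ f : C → ℤ, ∑ c, f c = f 0 + ∑ c ∈ Finset.univ.erase 0, f c := fun f =>
    (Finset.add_sum_erase _ f (Finset.mem_univ 0)).symm
  have hval : ∀ c ∈ (Finset.univ : Finset C).erase 0,
      leeDev (c : Fin n → ZMod 4) = t ∨ leeDev (c : Fin n → ZMod 4) = 0 ∨
        leeDev (c : Fin n → ZMod 4) = -t := fun c hc =>
    hwt c c.2 (by simpa using hc)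
  have hcard : ((Finset.univ : Finset C).erase 0).card + 1 = 2 ^ m := by
    rw [Finset.card_erase_add_one (Finset.mem_univ 0), Finset.card_univ, hm]
  have hm1 := sum_leeDev C hC
  have hm2 := two_mul_sum_leeDev_sq C hC
  have hm3 := card_dvd_four_mul_sum_leeDev_cube C
  rw [hsplit] at hm1 hm2 hm3
  simp only [Submodule.coe_zero, leeDev_zero, hm] at hm1 hm2 hm3
  push_cast at hm2 hm3
  have htn' : t ∣ n := by
    rw [← Int.natCast_dvd_natCast]
    have h : (t : ℤ) ∣ ∑ c ∈ (Finset.univ : Finset C).erase 0, leeDev (c : Fin n → ZMod 4) := by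
      refine Finset.dvd_sum fun c hc => ?_
      rcases hval c hc with h | h | h <;> simp [h]
    rw [eq_neg_of_add_eq_zero_left hm1]
    exact h.neg_right
  refine ⟨?_, htn'⟩
  obtain ⟨s, rfl⟩ := htn'
  have hcube : ∑ c ∈ (Finset.univ : Finset C).erase 0, leeDev (c : Fin (t * s) → ZMod 4) ^ 3 =
      t ^ 2 * ∑ c ∈ (Finset.univ : Finset C).erase 0, leeDev (c : Fin (t * s) → ZMod 4) := by
    rw [Finset.mul_sum]
    refine Finset.sum_congr rfl fun c hc => ?_
    rcases hval c hc with h | h | h <;> rw [h] <;> ring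
  have hsq : ∑ c ∈ (Finset.univ : Finset C).erase 0, leeDev (c : Fin (t * s) → ZMod 4) ^ 2 ≤
      t ^ 2 * (2 ^ m - 1) := by
    have h := Finset.sum_le_card_nsmul ((Finset.univ : Finset C).erase 0)
      (fun c => leeDev (c : Fin (t * s) → ZMod 4) ^ 2) ((t : ℤ) ^ 2) fun c hc => by
        rcases hval c hc with h | h | h <;> simp [h]
    rw [nsmul_eq_mul] at h
    have e : (((Finset.univ : Finset C).erase 0).card : ℤ) = 2 ^ m - 1 := by
      rw [eq_sub_iff_add_eq]
      exact_mod_cast hcard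
    rw [e] at h
    linarith
  have hlow : 2 * (t : ℤ) ^ 2 ≤
      ∑ c ∈ (Finset.univ : Finset C).erase 0, (leeDev (c : Fin (t * s) → ZMod 4) ^ 2 +
        t * leeDev (c : Fin (t * s) → ZMod 4)) := by
    obtain ⟨c, hc, hc0, hct⟩ := hex
    refine le_trans (le_of_eq ?_) (Finset.single_le_sum (fun x hx => ?_)
      (Finset.mem_erase.2 ⟨?_, Finset.mem_univ (⟨c, hc⟩ : C)⟩))
    · rw [hct]; ring
    · rcases hval x hx with h | h | h <;> rw [h] <;> nlinarith [sq_nonneg (t : ℤ)]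
    · simpa using hc0
  rw [Finset.sum_add_distrib, ← Finset.mul_sum] at hlow
  rw [hcube] at hm3
  generalize ∑ c ∈ (Finset.univ : Finset C).erase 0, leeDev (c : Fin (t * s) → ZMod 4) ^ 2 = Q
    at hm2 hsq hlow
  rw [eq_neg_of_add_eq_zero_right hm1] at hm3 hlow
  push_cast at hm2 hm3 hlow
  have hs2 : 2 ≤ s := by
    by_contra! hs
    interval_cases s <;> omega
  have ht' : (0 : ℤ) < t := by exact_mod_cast ht
  have hs' : (0 : ℤ) < s := by exact_mod_cast (by omega : 0 < s)
  have hts : (0 : ℤ) < t * s := mul_pos ht' hs'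
  have hlow' : 2 * (t * s : ℤ) + 2 * t < 2 ^ m := by
    refine lt_of_mul_lt_mul_left (a := (t * s : ℤ)) ?_ hts.le
    nlinarith
  by_contra hr
  have hfin := two_pow_le_of_not_dvd (r := r) (m := m) ht hs2 hr ?_ hlow' ?_
  · have h1 : 2 * (t * s) + 2 * t < 2 ^ m := by exact_mod_cast hlow'
    omega
  · convert hm3 using 2
    ring
  · refine le_of_mul_le_mul_left (a := (t : ℤ)) ?_ ht'
    nlinarith

/-- For every `r ≥ 1` there is a bound `N` such that every projective three-Lee-weight
Z4-linear code of length `n ≥ N` with weights `w1 < w2 < w3` satisfying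
`w1 + w2 + w3 = 3n` and `w2 = n` has `2^r ∣ n` and `2^(r-1) ∣ w1, w2, w3`. -/
theorem stmt19 (r : ℕ) (hr : 1 ≤ r) :
    ∃ N : ℕ, ∀ n : ℕ, N ≤ n →
      ∀ (C : Submodule (ZMod 4) (Fin n → ZMod 4)) (w1 w2 w3 : ℕ),
        w1 < w2 → w2 < w3 →
        {w : ℕ | ∃ c ∈ C, c ≠ 0 ∧ leeWtVec c = w} = {w1, w2, w3} →
        (∀ d ∈ dualCode C, d ≠ 0 → 3 ≤ leeWtVec d) →
        w1 + w2 + w3 = 3 * n → w2 = n →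
        2 ^ r ∣ n ∧ 2 ^ (r - 1) ∣ w1 ∧ 2 ^ (r - 1) ∣ w2 ∧ 2 ^ (r - 1) ∣ w3 := by
  refine ⟨(2 ^ (3 * r + 4)) ^ 6, fun n hn C w1 w2 w3 h12 h23 hset hC hsum hw2 => ?_⟩
  subst hw2
  have hdev : ∀ c : Fin w2 → ZMod 4, leeDev c = w2 - leeWtVec c := sum_leeChar
  have hmem : ∀ w ∈ ({w1, w2, w3} : Set ℕ), ∃ c ∈ C, c ≠ 0 ∧ leeWtVec c = w := by
    rw [← hset]
    exact fun w hw => hw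
  obtain ⟨c, hc, hc0, hcw⟩ := hmem w1 (by simp)
  have hw1 : 0 < w1 := hcw ▸ leeWtVec_pos hc0
  obtain ⟨hrt, htn⟩ := two_pow_dvd_and_dvd_of_three_weights (t := w2 - w1) (r := r) C hC
    (by omega) (by omega)
    (fun x hx hx0 => by
      have h : leeWtVec x ∈ ({w1, w2, w3} : Set ℕ) := hset ▸ ⟨x, hx, hx0, rfl⟩
      simp only [Set.mem_insert_iff, Set.mem_singleton_iff] at h
      rw [hdev]
      omega)
    ⟨c, hc, hc0, by rw [hdev]; omega⟩ hn
  have hn' := hrt.trans htn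
  have hpow : 2 ^ (r - 1) ∣ 2 ^ r := pow_dvd_pow 2 (Nat.sub_le r 1)
  have e1 : w1 = w2 - (w2 - w1) := by omega
  have e3 : w3 = w2 + (w2 - w1) := by omega
  refine ⟨hn', hpow.trans ?_, hpow.trans hn', hpow.trans ?_⟩
  · rw [e1]
    exact Nat.dvd_sub hn' hrt
  · rw [e3]
    exact dvd_add hn' hrt
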